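/- Let q be a prime power and let C0 = RS(Δ0,k0) be a Reed–Solomon code over F_q with weight enumerator g0(s). Define F1(δ) = h_q(δ) + δ·log_q(q−1) + 2·sup_{s>0}( δ·log_q(s) − (1/Δ0)·log_q(g0(s)) ) for δ ∈ (0,1). Suppose δ1 ∈ (0,1) satisfies F1(δ1) = 0 and F1(δ) > 0 for all δ ∈ (0,δ1). Then for every ε ∈ (0,δ1), the fraction of quadruples (π1,c1,π2,c2) indexing the ensemble E1(Δ0,b) (with n = bΔ0) whose code C(π1,c1,π2,c2) has minimum distance at least (δ1 − ε)·n tends to 1 as b → ∞. -/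

import Mathlib

section aux
open Finset


theorem aux_fact (w k : ℕ) : w.factorial * w ^ k ≤ k.factorial * w ^ w := by
  rcases le_total w k with h | h
  · have := Nat.factorial_mul_pow_sub_le_factorial h
    calc w.factorial * w ^ k = (w.factorial * w ^ (k - w)) * w ^ w := by
          rw [mul_assoc, ← pow_add]; congr 2; omega
      _ ≤ _ := Nat.mul_le_mul_right _ this
  · have h1 := Nat.factorial_mul_descFactorial (show w - k ≤ w by omega)
    have h2 := Nat.descFactorial_le_pow w (w - k)
    have h3 : w - (w - k) = k := by omega
    rw [h3] at h1
    calc w.factorial * w ^ k = k.factorial * (w.descFactorial (w-k) * w ^ k) := by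
          rw [← h1]; ring
      _ ≤ k.factorial * (w ^ (w - k) * w ^ k) := by gcongr
      _ = _ := by rw [← pow_add]; congr 2; omega

theorem aux_binom (n w : ℕ) (hw : w ≤ n) :
    n ^ n ≤ (n + 1) * (n.choose w * (w ^ w * (n - w) ^ (n - w))) := by
  have key : ∀ k ∈ range (n+1), w ^ k * (n - w) ^ (n - k) * n.choose k ≤
      n.choose w * (w ^ w * (n - w) ^ (n - w)) := by
    intro k hk
    have hk : k ≤ n := by simpa [Nat.lt_succ_iff] using hk
    have h1 := aux_fact w k
    have h2 := aux_fact (n - w) (n - k)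
    have h3 := Nat.choose_mul_factorial_mul_factorial hk
    have h4 := Nat.choose_mul_factorial_mul_factorial hw
    have hp : 0 < w.factorial * (n-w).factorial * (k.factorial * (n-k).factorial) := by positivity
    refine le_of_mul_le_mul_right ?_ hp
    calc w ^ k * (n - w) ^ (n - k) * n.choose k * (w.factorial * (n-w).factorial * (k.factorial * (n-k).factorial))
        = (n.choose k * k.factorial * (n-k).factorial) * ((w.factorial * w ^ k) * ((n-w).factorial * (n - w) ^ (n - k))) := by ring
      _ ≤ (n.choose k * k.factorial * (n-k).factorial) * ((k.factorial * w ^ w) * ((n-k).factorial * (n - w) ^ (n - w))) := by gcongr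
      _ = (n.choose w * w.factorial * (n-w).factorial) * ((k.factorial * w ^ w) * ((n-k).factorial * (n - w) ^ (n - w))) := by rw [h3, h4]
      _ = _ := by ring
  calc n ^ n = (w + (n - w)) ^ n := by congr 1; omega
    _ = ∑ k ∈ range (n+1), w ^ k * (n - w) ^ (n - k) * n.choose k := by rw [add_pow]; simp
    _ ≤ ∑ k ∈ range (n+1), n.choose w * (w ^ w * (n - w) ^ (n - w)) := sum_le_sum key
    _ = _ := by simp

theorem aux_binom_exp (n w : ℕ) (hw0 : 0 < w) (hw : w < n) :
    Real.exp (n * Real.binEntropy ((w:ℝ) / n)) ≤ (n + 1) * (n.choose w : ℝ) := by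
  have h := aux_binom n w hw.le
  have h' : (n:ℝ)^n ≤ (n+1) * (n.choose w * ((w:ℝ)^w * ((n - w : ℕ):ℝ)^(n-w))) := by exact_mod_cast h
  have hm : 0 < n - w := by omega
  have hmr : (0:ℝ) < ((n - w : ℕ):ℝ) := by exact_mod_cast hm
  have hwr : (0:ℝ) < w := by exact_mod_cast hw0
  have hnr : (0:ℝ) < n := by exact_mod_cast hw0.trans hw
  have hmc : ((n - w : ℕ):ℝ) = n - w := by push_cast [hw.le]; ring
  have he : Real.exp (n * Real.binEntropy ((w:ℝ) / n)) = (n:ℝ)^n / ((w:ℝ)^w * ((n - w : ℕ):ℝ)^(n-w)) := by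
    rw [← Real.exp_log (show 0 < (n:ℝ)^n / ((w:ℝ)^w * ((n - w : ℕ):ℝ)^(n-w)) by positivity)]
    congr 1
    rw [Real.log_div (by positivity) (by positivity), Real.log_mul (by positivity) (by positivity),
      Real.log_pow, Real.log_pow, Real.log_pow, Real.binEntropy,
      show 1 - (w:ℝ)/n = ((n - w : ℕ):ℝ)/n by rw [hmc]; field_simp, Real.log_inv, Real.log_inv,
      Real.log_div (by positivity) (by positivity), Real.log_div (by positivity) (by positivity), hmc]
    field_simp
    ring
  rw [he, div_le_iff₀ (by positivity)]
  linarith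

section
set_option linter.unusedSectionVars false
variable {F : Type} [Field F] [Fintype F] [DecidableEq F]

theorem aux_sphere {J : Type} [Fintype J] [DecidableEq J] (w : ℕ) :
    (univ.filter (fun x : J → F => hammingNorm x = w)).card =
      (Fintype.card J).choose w * (Fintype.card F - 1) ^ w := by
  have h : univ.filter (fun x : J → F => hammingNorm x = w) =
      (powersetCard w (univ : Finset J)).biUnion
        (fun S => Fintype.piFinset (fun i => if i ∈ S then univ.erase (0:F) else {0})) := by
    ext x
    simp only [mem_filter, mem_univ, true_and, mem_biUnion, mem_powersetCard, subset_univ,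
      Fintype.mem_piFinset]
    constructor
    · intro hx
      refine ⟨univ.filter (fun i => x i ≠ 0), hx, fun i => ?_⟩
      by_cases hi : x i = 0 <;> simp [hi]
    · rintro ⟨S, hS, hx⟩
      rw [← hS]
      unfold hammingNorm
      congr 1
      ext i
      have := hx i
      by_cases hi : i ∈ S <;> simp_all
  rw [h, card_biUnion]
  · rw [sum_congr rfl (g := fun _ => (Fintype.card F - 1) ^ w)]
    · simp
    · intro S hS
      rw [mem_powersetCard] at hS
      rw [Fintype.card_piFinset]
      simp only [apply_ite Finset.card, card_singleton, prod_ite, prod_const]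
      simp [hS.2]
  · intro S _ T _ hST
    rw [Function.onFun, disjoint_left]
    intro x hx hy
    apply hST
    simp only [Fintype.mem_piFinset] at hx hy
    ext i
    have h1 := hx i
    have h2 := hy i
    by_cases h3 : i ∈ S <;> by_cases h4 : i ∈ T <;> simp_all

theorem aux_trans {J : Type} [Fintype J] [DecidableEq J] (x y : J → F)
    (h : hammingNorm x = hammingNorm y) :
    ∃ (π : Equiv.Perm J) (c : J → F), (∀ j, c j ≠ 0) ∧ ∀ j, x j = c j * y (π j) := by
  obtain ⟨σ, hσ⟩ := Equiv.Perm.exists_map_finset_eq (univ.filter (fun i => x i ≠ 0))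
    (univ.filter (fun i => y i ≠ 0)) h
  have hs : ∀ j, x j ≠ 0 ↔ y (σ j) ≠ 0 := by
    intro j
    have := congrArg (fun s => σ j ∈ s) hσ
    simpa using this
  refine ⟨σ, fun j => if x j = 0 then 1 else x j / y (σ j), ?_, ?_⟩
  · intro j
    by_cases hj : x j = 0
    · simp [hj]
    · simp [hj]; exact (hs j).1 hj
  · intro j
    by_cases hj : x j = 0
    · have : y (σ j) = 0 := by
        by_contra h'; exact (hs j).2 h' hj
      simp [hj, this]
    · have := (hs j).1 hj
      simp [hj]; field_simp

abbrev MM (J F : Type) [Field F] := Equiv.Perm J × {c : J → F // ∀ j, c j ≠ 0}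

def phi {J : Type} (m : MM J F) (x : J → F) : J → F := fun j => (m.2 : J → F) j * x (m.1 j)

theorem phi_norm {J : Type} [Fintype J] [DecidableEq J] (m : MM J F) (x : J → F) :
    hammingNorm (phi m x) = hammingNorm x := by
  unfold hammingNorm phi
  apply card_bij (fun i _ => m.1 i)
  · intro i hi; simp at hi ⊢; exact hi.2
  · intro a _ b _ h; simpa using h
  · intro b hb
    refine ⟨m.1.symm b, ?_, by simp⟩
    simp at hb ⊢; exact ⟨m.2.2 _, hb⟩

/-- composition: phi m (phi m0 x) = phi (comp m0 m) x -/
def mcomp {J : Type} (m0 m : MM J F) : MM J F :=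
  (m.1.trans m0.1, ⟨fun j => (m.2 : J → F) j * (m0.2 : J → F) (m.1 j),
    fun j => mul_ne_zero (m.2.2 j) (m0.2.2 _)⟩)

theorem phi_mcomp {J : Type} (m0 m : MM J F) (x : J → F) :
    phi m (phi m0 x) = phi (mcomp m0 m) x := by
  ext j; simp [phi, mcomp, mul_assoc]

theorem phi_inj {J : Type} (m : MM J F) : Function.Injective (phi m) := by
  intro x y h
  ext j
  have := congrFun h (m.1.symm j)
  simpa [phi, m.2.2] using this

theorem mcomp_inj {J : Type} (m0 : MM J F) : Function.Injective (mcomp m0) := by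
  rintro ⟨a, c, hc⟩ ⟨b, d, hd⟩ h
  simp only [mcomp, Prod.mk.injEq, Subtype.mk.injEq] at h
  obtain ⟨h1, h2⟩ := h
  have hab : a = b := by
    ext j
    have := congrArg (fun e => e j) h1
    simpa using this
  subst hab
  congr 1
  apply Subtype.ext
  ext j
  have := congrFun h2 j
  simpa [m0.2.2] using this

open Classical in
theorem aux_N_le {J : Type} [Fintype J] [DecidableEq J] (P : (J → F) → Prop) (x y : J → F)
    (h : hammingNorm x = hammingNorm y) :
    (univ.filter (fun m : MM J F => P (phi m x))).card ≤
      (univ.filter (fun m : MM J F => P (phi m y))).card := by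
  obtain ⟨π, c, hc, hx⟩ := aux_trans x y h
  have hxe : x = phi ((π, ⟨c, hc⟩) : MM J F) y := by ext j; simp [phi, hx]
  apply card_le_card_of_injOn (mcomp ((π, ⟨c, hc⟩) : MM J F))
  · intro m hm
    simp only [coe_filter, mem_univ, true_and, Set.mem_ofPred_eq] at hm ⊢
    rw [hxe, phi_mcomp] at hm
    exact hm
  · exact (mcomp_inj _).injOn

open Classical in
theorem aux_N {J : Type} [Fintype J] [DecidableEq J] (P : (J → F) → Prop) (x : J → F) (w : ℕ)
    (h : hammingNorm x = w) :
    (univ.filter (fun m : MM J F => P (phi m x))).card *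
      (univ.filter (fun x : J → F => hammingNorm x = w)).card =
    Fintype.card (MM J F) * (univ.filter (fun x : J → F => P x ∧ hammingNorm x = w)).card := by
  have h1 : ∀ y ∈ univ.filter (fun x : J → F => hammingNorm x = w),
      (univ.filter (fun m : MM J F => P (phi m y))).card =
      (univ.filter (fun m : MM J F => P (phi m x))).card := by
    intro y hy
    simp at hy
    exact le_antisymm (aux_N_le P y x (by rw [hy, h])) (aux_N_le P x y (by rw [hy, h]))
  have h2 : ∀ m ∈ (univ : Finset (MM J F)), 
      ((univ.filter (fun x : J → F => hammingNorm x = w)).filter (fun y => P (phi m y))).card =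
      (univ.filter (fun x : J → F => P x ∧ hammingNorm x = w)).card := by
    intro m _
    have hb : Function.Bijective (phi m) := (phi_inj m).bijective_of_finite
    apply card_bij (fun y _ => phi m y)
    · intro y hy; simp at hy ⊢; exact ⟨hy.2, by rw [phi_norm]; exact hy.1⟩
    · intro a _ b _ h; exact phi_inj m h
    · intro b hb'
      obtain ⟨a, rfl⟩ := hb.2 b
      simp [phi_norm] at hb' ⊢
      exact ⟨a, ⟨hb'.2, hb'.1⟩, rfl⟩
  have := sum_card_bipartiteAbove_eq_sum_card_bipartiteBelow
    (s := univ.filter (fun x : J → F => hammingNorm x = w)) (t := (univ : Finset (MM J F)))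
    (fun y m => P (phi m y))
  unfold bipartiteAbove bipartiteBelow at this
  rw [sum_congr rfl h1, sum_congr rfl h2] at this
  simp only [sum_const, smul_eq_mul, card_univ] at this
  rw [mul_comm]; exact this

open Classical in
/-- first moment -/
theorem aux_first {J : Type} [Fintype J] [DecidableEq J] (P : (J → F) → Prop) (θ : ℝ) :
    (Fintype.card (MM J F × MM J F) : ℝ) -
    (Nat.card {t : MM J F × MM J F // ∀ x : J → F, P (phi t.1 x) → P (phi t.2 x) → x ≠ 0 →
      θ ≤ (hammingNorm x : ℝ)} : ℝ) ≤
    (Fintype.card (MM J F × MM J F) : ℝ) *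
     ∑ w ∈ (range (Fintype.card J + 1)).filter (fun w : ℕ => 1 ≤ w ∧ (w:ℝ) < θ),
      ((univ.filter (fun x : J → F => P x ∧ hammingNorm x = w)).card : ℝ)^2 /
      ((univ.filter (fun x : J → F => hammingNorm x = w)).card : ℝ) := by
  set W := (range (Fintype.card J + 1)).filter (fun w : ℕ => 1 ≤ w ∧ (w:ℝ) < θ)
  set good : Finset (MM J F × MM J F) := univ.filter (fun t => ∀ x : J → F, P (phi t.1 x) → P (phi t.2 x) → x ≠ 0 →
      θ ≤ (hammingNorm x : ℝ))
  have e1 : Nat.card {t : MM J F × MM J F // ∀ x : J → F, P (phi t.1 x) → P (phi t.2 x) → x ≠ 0 →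
      θ ≤ (hammingNorm x : ℝ)} = good.card := by
    rw [Nat.card_eq_fintype_card, Fintype.card_subtype]
  have e2 : goodᶜ ⊆ W.biUnion (fun w => (univ.filter (fun x : J → F => hammingNorm x = w)).biUnion
      (fun x => (univ.filter (fun m : MM J F => P (phi m x))) ×ˢ (univ.filter (fun m : MM J F => P (phi m x))))) := by
    intro t ht
    simp only [good, compl_filter, mem_filter, mem_univ, true_and] at ht
    push Not at ht
    obtain ⟨x, h1, h2, h3, h4⟩ := ht
    simp only [mem_biUnion, W, mem_filter, mem_range, mem_univ, true_and, mem_product]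
    refine ⟨hammingNorm x, ⟨?_, ?_, h4⟩, x, rfl, h1, h2⟩
    · exact Nat.lt_succ_of_le hammingNorm_le_card_fintype
    · exact hammingNorm_pos_iff.2 h3
  have e3 : (Fintype.card (MM J F × MM J F) : ℝ) - good.card = goodᶜ.card := by
    rw [card_compl, Nat.cast_sub (card_le_univ _)]
  rw [e1, e3]
  have e4 : goodᶜ.card ≤ ∑ w ∈ W, ∑ x ∈ univ.filter (fun x : J → F => hammingNorm x = w),
      (univ.filter (fun m : MM J F => P (phi m x))).card ^ 2 := by
    refine (card_le_card e2).trans (card_biUnion_le.trans (sum_le_sum fun w _ => ?_))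
    refine card_biUnion_le.trans (sum_le_sum fun x _ => ?_)
    rw [card_product, sq]
  have e4' : (goodᶜ.card : ℝ) ≤ ∑ w ∈ W, ∑ x ∈ univ.filter (fun x : J → F => hammingNorm x = w),
      ((univ.filter (fun m : MM J F => P (phi m x))).card : ℝ) ^ 2 := by exact_mod_cast e4
  refine e4'.trans ?_
  rw [mul_sum]
  apply sum_le_sum
  intro w hw
  set S : Finset (J → F) := univ.filter (fun x : J → F => hammingNorm x = w)
  rcases S.eq_empty_or_nonempty with hS | hS
  · simp [hS]
  have hSp : (0:ℝ) < S.card := by exact_mod_cast hS.card_pos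
  set A : ℝ := ((univ.filter (fun x : J → F => P x ∧ hammingNorm x = w)).card : ℝ)
  have : ∀ x ∈ S, ((univ.filter (fun m : MM J F => P (phi m x))).card : ℝ) ^ 2 =
      (Fintype.card (MM J F) * A / S.card)^2 := by
    intro x hx
    have hx' : hammingNorm x = w := by simpa [S] using hx
    have h := aux_N P x w hx'
    have h' : ((univ.filter (fun m : MM J F => P (phi m x))).card : ℝ) * S.card =
      Fintype.card (MM J F) * A := by
      simp only [A, S]; exact_mod_cast h
    congr 1
    rw [← h']; field_simp
  rw [sum_congr rfl this, sum_const, nsmul_eq_mul, Fintype.card_prod (MM J F) (MM J F)]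
  apply le_of_eq
  push_cast
  field_simp

theorem norm_split {b Δ : ℕ} (x : Fin b × Fin Δ → F) :
    hammingNorm x = ∑ i, hammingNorm (fun j => x (i, j)) := by
  unfold hammingNorm
  simp only [card_filter]
  rw [Fintype.sum_prod_type]

theorem aux_gen {b Δ : ℕ} (C : Finset (Fin Δ → F)) (s : ℝ) (hs : 0 < s) (w : ℕ) :
    ((univ.filter (fun x : Fin b × Fin Δ → F => (∀ i, (fun j => x (i,j)) ∈ C) ∧ hammingNorm x = w)).card : ℝ)
      * s ^ w ≤ (∑ y ∈ C, s ^ hammingNorm y) ^ b := by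
  have h := prod_univ_sum (fun _ : Fin b => C) (fun _ y => s ^ hammingNorm y)
  simp only [prod_const, card_univ, Fintype.card_fin] at h
  rw [h, ← nsmul_eq_mul, ← sum_const]
  have : ∀ x ∈ (univ.filter (fun x : Fin b × Fin Δ → F => (∀ i, (fun j => x (i,j)) ∈ C) ∧ hammingNorm x = w)),
      s ^ w = ∏ i, s ^ hammingNorm (Function.curry x i) := by
    intro x hx
    simp only [mem_filter, mem_univ, true_and] at hx
    rw [← hx.2, norm_split, ← prod_pow_eq_pow_sum]; rfl
  rw [sum_congr rfl this, ← sum_image (f := fun p : Fin b → Fin Δ → F => ∏ i, s ^ hammingNorm (p i)) (g := Function.curry)]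
  · apply sum_le_sum_of_subset_of_nonneg
    · intro p hp
      simp only [mem_image, mem_filter, mem_univ, true_and] at hp
      obtain ⟨x, hx, rfl⟩ := hp
      simp only [Fintype.mem_piFinset]
      exact hx.1
    · intros; positivity
  · intro x _ y _ h
    exact Function.curry_injective h
end
theorem aux_choose_low (n w : ℕ) (hw : w ≤ n) : n ^ w ≤ w ^ w * n.choose w := by
  have h : n ^ w * w.factorial ≤ w ^ w * n.descFactorial w := by
    rw [← Nat.descFactorial_self w, Nat.descFactorial_eq_prod_range, Nat.descFactorial_eq_prod_range]
    rw [show n ^ w = ∏ _i ∈ range w, n by simp, show w ^ w = ∏ _i ∈ range w, w by simp,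
      ← prod_mul_distrib, ← prod_mul_distrib]
    apply prod_le_prod' 
    intro i hi
    have hi : i < w := by simpa using hi
    obtain ⟨a, rfl⟩ := Nat.exists_eq_add_of_lt hi
    obtain ⟨c, rfl⟩ := Nat.exists_eq_add_of_le hw
    rw [show i + a + 1 - i = a + 1 by omega, show i + a + 1 + c - i = a + 1 + c by omega]
    nlinarith
  rw [Nat.descFactorial_eq_factorial_mul_choose] at h
  have hp := Nat.factorial_pos w
  refine le_of_mul_le_mul_right ?_ hp
  nlinarith

noncomputable def Phi (Δ : ℕ) (Q : ℝ) (g : ℝ → ℝ) (δ s : ℝ) : ℝ :=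
  Real.binEntropy δ + δ * Real.log Q + 2 * (δ * Real.log s - (1 / (Δ:ℝ)) * Real.log (g s))

theorem aux_compact (Δ : ℕ) (Q : ℝ) (g : ℝ → ℝ) (δ1 η θ : ℝ) (hη : 0 < η) (hθ : θ < δ1)
    (hpos : ∀ δ, 0 < δ → δ < δ1 → ∃ s, 0 < s ∧ 0 < Phi Δ Q g δ s) :
    ∃ c, 0 < c ∧ ∀ δ ∈ Set.Icc η θ, ∃ s, 0 < s ∧ c ≤ Phi Δ Q g δ s := by
  refine (isCompact_Icc (a := η) (b := θ)).induction_on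
    (p := fun S => ∃ c, 0 < c ∧ ∀ δ ∈ S, ∃ s, 0 < s ∧ c ≤ Phi Δ Q g δ s) ?_ ?_ ?_ ?_
  · exact ⟨1, one_pos, by simp⟩
  · rintro S T hST ⟨c, hc, h⟩
    exact ⟨c, hc, fun δ hδ => h δ (hST hδ)⟩
  · rintro S T ⟨c, hc, h⟩ ⟨d, hd, h'⟩
    refine ⟨min c d, lt_min hc hd, ?_⟩
    rintro δ (hδ | hδ)
    · obtain ⟨s, h1, h2⟩ := h δ hδ
      exact ⟨s, h1, (min_le_left _ _).trans h2⟩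
    · obtain ⟨s, h1, h2⟩ := h' δ hδ
      exact ⟨s, h1, (min_le_right _ _).trans h2⟩
  · intro δ hδ
    obtain ⟨s, hs, hp⟩ := hpos δ (hη.trans_le hδ.1) (hδ.2.trans_lt hθ)
    have hcont : Continuous (fun δ => Phi Δ Q g δ s) := by
      unfold Phi; fun_prop
    have hev : ∀ᶠ x in nhds δ, Phi Δ Q g δ s / 2 < Phi Δ Q g x s :=
      hcont.continuousAt.eventually (lt_mem_nhds (by linarith))
    refine ⟨_, mem_nhdsWithin_of_mem_nhds hev, Phi Δ Q g δ s / 2, by linarith, ?_⟩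
    intro x hx
    exact ⟨s, hs, le_of_lt hx⟩

theorem aux_mid (Δ b w : ℕ) (Q : ℝ) (hQ : 1 ≤ Q) (g : ℝ → ℝ) (A c s : ℝ) (hA0 : 0 ≤ A)
    (hs : 0 < s) (hgs : 0 < g s) (hA : A * s ^ w ≤ g s ^ b) (hw0 : 0 < w) (hw : w < b * Δ)
    (hc : c ≤ Phi Δ Q g ((w:ℝ) / (b * Δ : ℕ)) s) :
    A ^ 2 / ((b * Δ).choose w * Q ^ w) ≤ ((b * Δ : ℕ) + 1) * Real.exp (- c * (b * Δ : ℕ)) := by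
  have hb := aux_binom_exp (b * Δ) w hw0 hw
  have hn : 0 < b * Δ := by omega
  have hΔ : 0 < Δ := Nat.pos_of_mul_pos_left hn
  set n := b * Δ with hn_def
  have hnr : (0:ℝ) < n := by exact_mod_cast hn
  have hΔr : (0:ℝ) < Δ := by exact_mod_cast hΔ
  have hnb : (n:ℝ) / Δ = b := by rw [hn_def]; push_cast; field_simp
  have hA1 : A ≤ Real.exp (b * Real.log (g s) - w * Real.log s) := by
    rw [Real.exp_sub, ← Real.log_pow, ← Real.log_pow, Real.exp_log (by positivity), Real.exp_log (by positivity),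
      le_div_iff₀ (by positivity)]
    exact hA
  have hA2 : A ^ 2 ≤ Real.exp (2 * (b * Real.log (g s) - w * Real.log s)) := by
    rw [two_mul, Real.exp_add, ← sq]; gcongr
  have hQw : Q ^ w = Real.exp (w * Real.log Q) := by
    rw [← Real.log_pow, Real.exp_log (by positivity)]
  have hC : (0:ℝ) < (n.choose w : ℝ) := by exact_mod_cast Nat.choose_pos hw.le
  rw [div_le_iff₀ (by positivity)]
  calc A ^ 2 ≤ _ := hA2
    _ ≤ Real.exp (-c * n) * Real.exp (n * Real.binEntropy ((w:ℝ)/n)) * Q ^ w := by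
        rw [hQw, ← Real.exp_add, ← Real.exp_add]
        apply Real.exp_le_exp.2
        have h1 : n * c ≤ n * Phi Δ Q g ((w:ℝ) / n) s := by gcongr
        have h2 : n * Phi Δ Q g ((w:ℝ) / n) s = n * Real.binEntropy ((w:ℝ)/n) + w * Real.log Q
            + 2 * (w * Real.log s - b * Real.log (g s)) := by
          unfold Phi
          rw [← hnb]; field_simp
        linarith
    _ ≤ Real.exp (-c * n) * ((n + 1) * n.choose w) * Q ^ w := by gcongr
    _ = _ := by ring

theorem aux_small (Δ b w : ℕ) (Q : ℝ) (hQ : 1 ≤ Q) (g : ℝ → ℝ) (A K : ℝ) (hA0 : 0 ≤ A) (hK : 0 ≤ K)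
    (hg0 : ∀ s, 0 < s → 0 < g s)
    (hg : ∀ s, 0 < s → s ≤ 1 → g s ≤ 1 + K * s ^ 3)
    (hA : ∀ s, 0 < s → A * s ^ w ≤ g s ^ b) (hw0 : 0 < w) (hw : w ≤ b * Δ) :
    A ^ 2 / ((b * Δ).choose w * Q ^ w) ≤
      (Real.exp (K / Δ) ^ 2 * ((w:ℝ) / (b * Δ : ℕ)) ^ (1/3 : ℝ)) ^ w := by
  have hn : 0 < b * Δ := by omega
  have hΔ : 0 < Δ := Nat.pos_of_mul_pos_left hn
  have hch := aux_choose_low (b * Δ) w hw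
  set n := b * Δ with hn_def
  have hnr : (0:ℝ) < n := by exact_mod_cast hn
  have hwr : (0:ℝ) < w := by exact_mod_cast hw0
  have hΔr : (0:ℝ) < Δ := by exact_mod_cast hΔ
  have hnb : (n:ℝ) / Δ = b := by rw [hn_def]; push_cast; field_simp
  have hwn : (w:ℝ) ≤ n := by exact_mod_cast hw
  set s := ((w:ℝ) / n) ^ (1/3 : ℝ) with hs_def
  have hs : 0 < s := by positivity
  have hs1 : s ≤ 1 := Real.rpow_le_one (by positivity) (by rw [div_le_one hnr]; exact hwn) (by norm_num)
  have hs3 : s ^ 3 = (w:ℝ) / n := by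
    rw [hs_def, ← Real.rpow_natCast, ← Real.rpow_mul (by positivity)]; norm_num
  have hgb : g s ^ b ≤ Real.exp (K / Δ) ^ w := by
    calc g s ^ b ≤ (Real.exp (K * s ^ 3)) ^ b := by
          have := hg0 s hs
          gcongr
          refine (hg s hs hs1).trans ?_
          have := Real.add_one_le_exp (K * s ^ 3)
          linarith
      _ = _ := by
          rw [← Real.exp_nat_mul, ← Real.exp_nat_mul, hs3, ← hnb]; congr 1; field_simp
  have h1 : A * s ^ w ≤ Real.exp (K / Δ) ^ w := (hA s hs).trans hgb
  have h2 : 1 ≤ (n.choose w : ℝ) * s ^ (3 * w) := by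
    rw [pow_mul, hs3, div_pow, ← mul_div_assoc, le_div_iff₀ (by positivity), one_mul]
    have : (n:ℝ)^w ≤ (w:ℝ)^w * n.choose w := by exact_mod_cast hch
    linarith
  have hC : (0:ℝ) < (n.choose w : ℝ) := by exact_mod_cast Nat.choose_pos hw
  have hQw : 1 ≤ Q ^ w := one_le_pow₀ hQ
  rw [div_le_iff₀ (by positivity)]
  have h3 : (A * s ^ w) ^ 2 ≤ (Real.exp (K / Δ) ^ w) ^ 2 := by gcongr
  have hsw : 0 < (s ^ w) ^ 2 := by positivity
  refine le_of_mul_le_mul_right ?_ hsw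
  calc A ^ 2 * (s ^ w) ^ 2 = (A * s ^ w) ^ 2 := by ring
    _ ≤ (Real.exp (K / Δ) ^ w) ^ 2 := h3
    _ = (Real.exp (K / Δ) ^ w) ^ 2 * (1 * 1) := by ring
    _ ≤ (Real.exp (K / Δ) ^ w) ^ 2 * ((n.choose w * s ^ (3 * w)) * Q ^ w) := by gcongr
    _ = _ := by rw [mul_pow]; ring

theorem aux_tendsto (Δ : ℕ) (hΔ : 0 < Δ) (Q : ℝ) (hQ : 1 ≤ Q) (g : ℝ → ℝ) (A : ℕ → ℕ → ℝ) (K : ℝ)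
    (hA0 : ∀ b w, 0 ≤ A b w) (hK : 0 ≤ K)
    (hg0 : ∀ s, 0 < s → 0 < g s)
    (hg : ∀ s, 0 < s → s ≤ 1 → g s ≤ 1 + K * s ^ 3)
    (hA : ∀ b w s, 0 < s → A b w * s ^ w ≤ g s ^ b)
    (δ1 θ : ℝ) (hδ1 : δ1 < 1) (hθ : θ < δ1)
    (hpos : ∀ δ, 0 < δ → δ < δ1 → ∃ s, 0 < s ∧ 0 < Phi Δ Q g δ s) :
    Filter.Tendsto (fun b : ℕ => ∑ w ∈ (range (b * Δ + 1)).filter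
      (fun w : ℕ => 1 ≤ w ∧ (w:ℝ) < θ * (b * Δ : ℕ)), A b w ^ 2 / ((b * Δ).choose w * Q ^ w))
      Filter.atTop (nhds 0) := by
  set E := Real.exp (K / Δ) ^ 2 with hE
  have hEp : 0 < E := by positivity
  set η : ℝ := (1 / (2 * E)) ^ 3 with hη_def
  have hη : 0 < η := by positivity
  obtain ⟨c, hc, hmid⟩ := aux_compact Δ Q g δ1 η θ hη hθ hpos
  have hsum : Summable (fun w : ℕ => (w:ℝ) * (1/2:ℝ)^w) := by
    simpa using summable_pow_mul_geometric_of_norm_lt_one 1 (r := (1/2:ℝ)) (by norm_num)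
  set S := ∑' w : ℕ, (w:ℝ) * (1/2:ℝ)^w
  have hbd : ∀ b : ℕ, 0 < b → ∑ w ∈ (range (b * Δ + 1)).filter
      (fun w : ℕ => 1 ≤ w ∧ (w:ℝ) < θ * (b * Δ : ℕ)), A b w ^ 2 / ((b * Δ).choose w * Q ^ w) ≤
      2 * E * S * ((b * Δ : ℕ) : ℝ) ^ (-(1/3) : ℝ) +
        ((b * Δ : ℕ) + 1) ^ 2 * Real.exp (- c * (b * Δ : ℕ)) := by
    intro b hb
    have hn : 0 < b * Δ := Nat.mul_pos hb hΔ
    set n := b * Δ with hn_def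
    have hnr : (0:ℝ) < n := by exact_mod_cast hn
    have hterm : ∀ w ∈ (range (n + 1)).filter (fun w : ℕ => 1 ≤ w ∧ (w:ℝ) < θ * n),
        A b w ^ 2 / (n.choose w * Q ^ w) ≤
          2 * E * (n : ℝ) ^ (-(1/3) : ℝ) * ((w:ℝ) * (1/2:ℝ)^w) + (n + 1) * Real.exp (-c * n) := by
      intro w hw
      simp only [mem_filter, mem_range] at hw
      obtain ⟨hwn, hw1, hwθ⟩ := hw
      have hwr : (1:ℝ) ≤ w := by exact_mod_cast hw1
      rcases le_total ((w:ℝ) / n) η with h | h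
      · have h1 := aux_small Δ b w Q hQ g (A b w) K (hA0 b w) hK hg0 hg (hA b w) hw1 (by omega)
        rw [← hn_def, ← hE] at h1
        have h2 : ((w:ℝ)/n)^(1/3:ℝ) ≤ 1 / (2 * E) := by
          calc ((w:ℝ)/n)^(1/3:ℝ) ≤ η ^ (1/3:ℝ) := by gcongr
            _ = 1 / (2 * E) := by
              rw [hη_def, ← Real.rpow_natCast, ← Real.rpow_mul (by positivity)]; norm_num
        have h3 : E * ((w:ℝ)/n)^(1/3:ℝ) ≤ 1/2 := by
          calc E * ((w:ℝ)/n)^(1/3:ℝ) ≤ E * (1 / (2 * E)) := by gcongr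
            _ = 1/2 := by field_simp
        have h4 : ((w:ℝ)/n)^(1/3:ℝ) ≤ w * (n:ℝ)^(-(1/3):ℝ) := by
          rw [Real.div_rpow (by positivity) (by positivity), Real.rpow_neg (by positivity), div_eq_mul_inv]
          gcongr
          calc (w:ℝ)^(1/3:ℝ) ≤ (w:ℝ)^(1:ℝ) := Real.rpow_le_rpow_of_exponent_le hwr (by norm_num)
            _ = w := Real.rpow_one _
        have h5 : (0:ℝ) ≤ (n + 1) * Real.exp (-c * n) := by positivity
        obtain ⟨v, rfl⟩ : ∃ v, w = v + 1 := ⟨w - 1, by omega⟩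
        calc _ ≤ _ := h1
          _ = (E * (((v+1:ℕ):ℝ)/n)^(1/3:ℝ)) ^ v * (E * (((v+1:ℕ):ℝ)/n)^(1/3:ℝ)) := pow_succ _ _
          _ ≤ (1/2)^v * (E * (((v+1:ℕ):ℝ) * (n:ℝ)^(-(1/3):ℝ))) := by gcongr
          _ = 2 * E * (n : ℝ) ^ (-(1/3) : ℝ) * (((v+1:ℕ):ℝ) * (1/2:ℝ)^(v+1)) := by rw [pow_succ]; ring
          _ ≤ _ := by linarith
      · have hθ' : (w:ℝ)/n ≤ θ := by rw [div_le_iff₀ hnr]; exact hwθ.le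
        obtain ⟨s, hs, hcs⟩ := hmid _ ⟨h, hθ'⟩
        have hwn' : w < n := by
          have : (w:ℝ) < n := by
            rw [div_le_iff₀ hnr] at hθ'
            nlinarith
          exact_mod_cast this
        have h1 := aux_mid Δ b w Q hQ g (A b w) c s (hA0 b w) hs (hg0 s hs) (hA b w s hs) hw1 hwn' hcs
        have h2 : 0 ≤ 2 * E * (n : ℝ) ^ (-(1/3) : ℝ) * ((w:ℝ) * (1/2:ℝ)^w) := by positivity
        rw [← hn_def] at h1
        linarith
    refine (sum_le_sum hterm).trans ?_
    rw [sum_add_distrib, ← mul_sum]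
    apply add_le_add
    · rw [mul_right_comm (2 * E) S]
      gcongr
      exact hsum.sum_le_tsum _ (fun _ _ => by positivity)
    · rw [sum_const, nsmul_eq_mul]
      have : ((((range (n + 1)).filter (fun w : ℕ => 1 ≤ w ∧ (w:ℝ) < θ * n)).card : ℕ) : ℝ) ≤ n + 1 := by
        have := card_filter_le (range (n+1)) (fun w : ℕ => 1 ≤ w ∧ (w:ℝ) < θ * n)
        rw [card_range] at this
        exact_mod_cast this
      calc _ ≤ ((n:ℝ) + 1) * ((n + 1) * Real.exp (-c * n)) := by gcongr
        _ = _ := by ring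
  have hnt : Filter.Tendsto (fun b : ℕ => ((b * Δ : ℕ) : ℝ)) Filter.atTop Filter.atTop := by
    apply tendsto_natCast_atTop_atTop.comp
    exact Filter.tendsto_id.atTop_mul_const' hΔ
  have hlim : Filter.Tendsto (fun x : ℝ => 2 * E * S * x ^ (-(1/3) : ℝ) +
        (x + 1) ^ 2 * Real.exp (- c * x)) Filter.atTop (nhds 0) := by
    have h1 := (tendsto_rpow_neg_atTop (show (0:ℝ) < 1/3 by norm_num)).const_mul (2 * E * S)
    have e : ∀ k : ℕ, Filter.Tendsto (fun x : ℝ => x ^ k * Real.exp (-c * x)) Filter.atTop (nhds 0) := by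
      intro k
      have := tendsto_rpow_mul_exp_neg_mul_atTop_nhds_zero k c hc
      simpa using this
    have h2 := ((e 2).add ((e 1).const_mul 2)).add (e 0)
    have h3 := h1.add h2
    simp only [mul_zero, add_zero] at h3
    refine h3.congr fun x => ?_
    ring
  refine tendsto_of_tendsto_of_tendsto_of_le_of_le' tendsto_const_nhds (hlim.comp hnt) ?_ ?_
  · filter_upwards with b
    apply sum_nonneg
    intro w _
    positivity
  · filter_upwards [Filter.eventually_gt_atTop 0] with b hb
    exact hbd b hb

theorem aux_exclude (Δ : ℕ) (hΔ : 0 < Δ) (Q : ℝ) (hQ : 1 ≤ Q) (g : ℝ → ℝ)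
    (hg : ∀ s, 0 < s → 1 + s ^ Δ ≤ g s) (s0 : ℝ) (hs0 : 0 < s0)
    (hsm : ∀ s, 0 < s → s ≤ s0 → 1 / 2 * Real.log (1 + Q * s ^ 2) ≤ (1 / (Δ:ℝ)) * Real.log (g s))
    (δ1 : ℝ) (hδ1 : 0 < δ1) (hδ1' : δ1 < 1) :
    ∃ δ, 0 < δ ∧ δ < δ1 ∧ ∀ s, 0 < s → Phi Δ Q g δ s ≤ 0 := by
  have hΔr : (0:ℝ) < Δ := by exact_mod_cast hΔ
  set L := (1 / (Δ:ℝ)) * Real.log (1 + s0 ^ Δ)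
  have hL : 0 < L := by
    have : 0 < Real.log (1 + s0 ^ Δ) := Real.log_pos (by have : 0 < s0 ^ Δ := by positivity
                                                         linarith)
    positivity
  have hcont : Continuous (fun δ : ℝ => Real.binEntropy δ + δ * Real.log Q - 2 * ((1 - δ) * L)) := by fun_prop
  have hev : ∀ᶠ δ in nhdsWithin (0:ℝ) (Set.Ioi 0), Real.binEntropy δ + δ * Real.log Q - 2 * ((1 - δ) * L) < 0 := by
    apply mem_nhdsWithin_of_mem_nhds
    apply hcont.continuousAt.eventually (gt_mem_nhds _)
    simp; exact hL
  have hev2 : ∀ᶠ δ in nhdsWithin (0:ℝ) (Set.Ioi 0), 0 < δ ∧ δ < δ1 := Ioo_mem_nhdsGT hδ1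
  obtain ⟨δ, hδ, hδ0, hδ2⟩ := (hev.and hev2).exists
  refine ⟨δ, hδ0, hδ2, fun s hs => ?_⟩
  have hδ3 : 0 < 1 - δ := by linarith
  unfold Phi
  rcases le_total s s0 with h | h
  · have h1 := hsm s hs h
    have h2 : Real.binEntropy δ + δ * Real.log Q + 2 * (δ * Real.log s) ≤ Real.log (1 + Q * s ^ 2) := by
      have hc := strictConcaveOn_log_Ioi.concaveOn.2 (x := Q * s ^ 2 / δ) (y := 1 / (1 - δ))
        (by simp only [Set.mem_Ioi]; positivity) (by simp only [Set.mem_Ioi]; positivity) hδ0.le hδ3.le (by ring)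
      simp only [smul_eq_mul] at hc
      have e : δ * (Q * s ^ 2 / δ) + (1 - δ) * (1 / (1 - δ)) = 1 + Q * s ^ 2 := by
        field_simp; ring
      rw [e, Real.log_div (by positivity) (by positivity), Real.log_mul (by positivity) (by positivity),
        Real.log_pow, one_div, Real.log_inv] at hc
      unfold Real.binEntropy
      rw [Real.log_inv, Real.log_inv]
      push_cast at hc
      linarith
    linarith
  · have hsp : 0 < s ^ Δ := by positivity
    have hgs := hg s hs
    have h1 : Real.log s ≤ (1 / (Δ:ℝ)) * Real.log (g s) := by
      have : Real.log (s ^ Δ) ≤ Real.log (g s) := Real.log_le_log hsp (by linarith)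
      rw [Real.log_pow] at this
      rw [one_div, ← div_eq_inv_mul, le_div_iff₀ hΔr]; linarith
    have h2 : L ≤ (1 / (Δ:ℝ)) * Real.log (g s) := by
      have : s0 ^ Δ ≤ s ^ Δ := by gcongr
      exact mul_le_mul_of_nonneg_left (Real.log_le_log (by positivity) (by linarith)) (by positivity)
    nlinarith
section
set_option linter.unusedSectionVars false
variable {F : Type} [Field F] [Fintype F] [DecidableEq F]

theorem rs_const {Δ k0 : ℕ} (hk0 : 1 ≤ k0) (hΔ : 0 < Δ) (α : Fin Δ → F)
    (C : Finset (Fin Δ → F))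
    (hC : ∀ y, y ∈ C ↔ ∃ p : Polynomial F, p.degree < (k0 : ℕ) ∧ ∀ j, y j = p.eval (α j))
    (s : ℝ) (hs : 0 < s) :
    1 + ((Fintype.card F : ℝ) - 1) * s ^ Δ ≤ ∑ y ∈ C, s ^ hammingNorm y := by
  set f : F → Fin Δ → F := fun c _ => c
  have hf : Function.Injective f := fun a b h => congrFun h ⟨0, hΔ⟩
  have hsub : univ.image f ⊆ C := by
    intro y hy
    obtain ⟨c, _, rfl⟩ := mem_image.1 hy
    rw [hC]
    refine ⟨Polynomial.C c, ?_, by simp [f]⟩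
    exact Polynomial.degree_C_le.trans_lt (by exact_mod_cast hk0)
  calc 1 + ((Fintype.card F : ℝ) - 1) * s ^ Δ = ∑ y ∈ univ.image f, s ^ hammingNorm y := by
        rw [sum_image hf.injOn, ← add_sum_erase _ _ (mem_univ (0:F))]
        have h0 : f 0 = 0 := rfl
        have h1 : ∀ c ∈ univ.erase (0:F), s ^ hammingNorm (f c) = s ^ Δ := by
          intro c hc
          have hc : c ≠ 0 := by simpa using hc
          simp [hammingNorm, f, hc]
        rw [sum_congr rfl h1, h0, hammingNorm_zero, sum_const, nsmul_eq_mul,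
          card_erase_of_mem (mem_univ _), card_univ, Nat.cast_sub Fintype.card_pos]
        simp
    _ ≤ _ := sum_le_sum_of_subset_of_nonneg hsub (by intros; positivity)

theorem rs_star {Δ k0 : ℕ} (hΔ : 2 ≤ Δ) (hk : Δ ≤ k0 + 1) (α : Fin Δ → F) (hα : Function.Injective α)
    (C : Finset (Fin Δ → F))
    (hC : ∀ y, y ∈ C ↔ ∃ p : Polynomial F, p.degree < (k0 : ℕ) ∧ ∀ j, y j = p.eval (α j))
    (s : ℝ) (hs : 0 < s) :
    1 + ((Δ : ℝ) - 1) * ((Fintype.card F : ℝ) - 1) * s ^ 2 ≤ ∑ y ∈ C, s ^ hammingNorm y := by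
  set z : Fin Δ := ⟨0, by omega⟩
  set p : Fin Δ × F → Polynomial F := fun t =>
    Polynomial.C t.2 * ∏ i ∈ (univ.erase z).erase t.1, (Polynomial.X - Polynomial.C (α i))
  set f : Fin Δ × F → Fin Δ → F := fun t i => (p t).eval (α i)
  set I := (univ.erase z) ×ˢ (univ.erase (0:F))
  have hz : ∀ t ∈ I, ∀ i, f t i ≠ 0 ↔ i ∈ ({z, t.1} : Finset (Fin Δ)) := by
    intro t ht i
    simp only [I, mem_product, mem_erase, mem_univ, and_true] at ht
    simp only [f, p, Polynomial.eval_mul, Polynomial.eval_C, Polynomial.eval_prod,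
      Polynomial.eval_sub, Polynomial.eval_X, ne_eq, mul_eq_zero, ht.2, false_or, prod_eq_zero_iff,
      sub_eq_zero, mem_erase, mem_univ, and_true, mem_insert, mem_singleton]
    constructor
    · intro h
      by_contra h'
      push Not at h'
      exact h ⟨i, ⟨h'.2, h'.1⟩, rfl⟩
    · rintro h ⟨a, ha, hb⟩
      have := hα hb
      subst this
      rcases h with h | h
      · exact ha.2 h
      · exact ha.1 h
  have hw : ∀ t ∈ I, hammingNorm (f t) = 2 := by
    intro t ht
    have : univ.filter (fun i => f t i ≠ 0) = {z, t.1} := by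
      ext i; simp only [mem_filter, mem_univ, true_and]; exact hz t ht i
    unfold hammingNorm
    rw [this, card_pair]
    simp only [I, mem_product, mem_erase, mem_univ, and_true] at ht
    exact fun h => ht.1 h.symm
  have hinj : Set.InjOn f I := by
    intro t ht u hu h
    have ht' := ht
    simp only [I, coe_product, Set.mem_prod, mem_coe, mem_erase, mem_univ, and_true] at ht'
    have h1 : t.1 = u.1 := by
      have h2 : f u t.1 ≠ 0 := by rw [← h]; rw [hz t ht]; simp
      rw [hz u hu] at h2
      simp only [mem_insert, mem_singleton] at h2
      exact h2.resolve_left ht'.1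
    have h3 : f t z = f u z := by rw [h]
    have h4 : f t z ≠ 0 := by rw [hz t ht]; simp
    have h5 : t.2 = u.2 := by
      simp only [f, p, Polynomial.eval_mul, Polynomial.eval_C] at h3 h4
      rw [← h1] at h3
      exact mul_right_cancel₀ (right_ne_zero_of_mul h4) h3
    exact Prod.ext h1 h5
  have hsub : insert 0 (I.image f) ⊆ C := by
    intro y hy
    rw [hC]
    rcases mem_insert.1 hy with rfl | hy
    · exact ⟨0, by simp, by simp⟩
    · obtain ⟨t, ht, rfl⟩ := mem_image.1 hy
      refine ⟨p t, ?_, fun _ => rfl⟩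
      simp only [I, mem_product, mem_erase, mem_univ, and_true] at ht
      have hcard : ((univ.erase z).erase t.1).card = Δ - 2 := by
        rw [card_erase_of_mem (by simp [ht.1]), card_erase_of_mem (mem_univ _)]; simp; omega
      simp only [p]
      rw [Polynomial.degree_C_mul ht.2, Polynomial.degree_prod]
      simp only [Polynomial.degree_X_sub_C, sum_const, hcard]
      rw [nsmul_eq_mul, mul_one]
      exact_mod_cast (by omega : Δ - 2 < k0)
  have h0 : (0 : Fin Δ → F) ∉ I.image f := by
    intro h
    obtain ⟨t, ht, h⟩ := mem_image.1 h
    have := hw t ht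
    rw [h] at this; simp at this
  calc _ = ∑ y ∈ insert 0 (I.image f), s ^ hammingNorm y := by
        rw [sum_insert h0, sum_image hinj, sum_congr rfl (fun t ht => by rw [hw t ht])]
        simp only [hammingNorm_zero, pow_zero, sum_const, nsmul_eq_mul, I, card_product,
          card_erase_of_mem (mem_univ _), card_univ, Fintype.card_fin]
        rw [Nat.cast_mul, Nat.cast_sub Fintype.card_pos, Nat.cast_sub (by omega)]
        simp
    _ ≤ _ := sum_le_sum_of_subset_of_nonneg hsub (by intros; positivity)

theorem rs_upper {Δ k0 : ℕ} (hk : k0 + 2 ≤ Δ) (α : Fin Δ → F) (hα : Function.Injective α)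
    (C : Finset (Fin Δ → F))
    (hC : ∀ y, y ∈ C ↔ ∃ p : Polynomial F, p.degree < (k0 : ℕ) ∧ ∀ j, y j = p.eval (α j))
    (s : ℝ) (hs : 0 < s) (hs1 : s ≤ 1) :
    ∑ y ∈ C, s ^ hammingNorm y ≤ 1 + (C.card : ℝ) * s ^ 3 := by
  have hw : ∀ y ∈ C, y ≠ 0 → 3 ≤ hammingNorm y := by
    intro y hy hy0
    obtain ⟨p, hp, h⟩ := (hC y).1 hy
    have hp0 : p ≠ 0 := by
      rintro rfl
      apply hy0; ext j; simp [h]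
    have h1 : (univ.filter (fun i => y i = 0)).card ≤ p.natDegree := by
      rw [← card_image_of_injective _ hα]
      apply Polynomial.card_le_degree_of_subset_roots
      intro a ha
      simp only [mem_val, mem_image, mem_filter, mem_univ, true_and] at ha
      obtain ⟨i, hi, rfl⟩ := ha
      rw [Polynomial.mem_roots hp0, Polynomial.IsRoot, ← h, hi]
    have h2 : p.natDegree < k0 := (Polynomial.natDegree_lt_iff_degree_lt hp0).2 hp
    have h3 := card_filter_add_card_filter_not (s := (univ : Finset (Fin Δ))) (fun i => y i = 0)
    rw [card_univ, Fintype.card_fin] at h3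
    unfold hammingNorm
    simp only [ne_eq]
    omega
  have h0 : (0 : Fin Δ → F) ∈ C := by
    rw [hC]; exact ⟨0, by simp, by simp⟩
  rw [← add_sum_erase _ _ h0, hammingNorm_zero, pow_zero]
  gcongr
  calc ∑ y ∈ C.erase 0, s ^ hammingNorm y ≤ ∑ y ∈ C.erase 0, s ^ 3 := by
        apply sum_le_sum
        intro y hy
        rw [mem_erase] at hy
        exact pow_le_pow_of_le_one hs.le hs1 (hw y hy.2 hy.1)
    _ = ((C.erase 0).card : ℝ) * s ^ 3 := by simp
    _ ≤ _ := by
        gcongr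
        exact erase_subset _ _
end

theorem aux_low (Δ : ℕ) (hΔ : 0 < Δ) (Q : ℝ) (hQ : 1 ≤ Q) (g : ℝ → ℝ)
    (h1 : ∀ s, 0 < s → 1 + Q * s ^ Δ ≤ g s)
    (h2 : 2 ≤ Δ → ∀ s, 0 < s → 1 + ((Δ:ℝ) - 1) * Q * s ^ 2 ≤ g s) :
    ∃ s0, 0 < s0 ∧ ∀ s, 0 < s → s ≤ s0 →
      1 / 2 * Real.log (1 + Q * s ^ 2) ≤ (1 / (Δ:ℝ)) * Real.log (g s) := by
  have hQ0 : 0 < Q := by linarith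
  rcases (show Δ = 1 ∨ Δ = 2 ∨ 3 ≤ Δ by omega) with rfl | rfl | h3
  · refine ⟨1, one_pos, fun s hs _ => ?_⟩
    have := h1 s hs
    have hp : 0 < Q * s := by positivity
    have e : Real.log (1 + Q * s ^ 2) ≤ Real.log (g s ^ 2) := by
      apply Real.log_le_log (by positivity)
      rw [pow_one] at this
      calc 1 + Q * s ^ 2 ≤ 1 + Q * Q * s ^ 2 := by
            have : Q * s ^ 2 ≤ Q * Q * s ^ 2 := by gcongr; nlinarith
            linarith
        _ ≤ (1 + Q * s) ^ 2 := by nlinarith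
        _ ≤ _ := by gcongr
    rw [Real.log_pow] at e
    push_cast at e ⊢
    linarith
  · refine ⟨1, one_pos, fun s hs _ => ?_⟩
    have := Real.log_le_log (by positivity) (h1 s hs)
    push_cast
    linarith
  · have hΔr : (3:ℝ) ≤ Δ := by exact_mod_cast h3
    set t : ℝ := 2 / (3 * Q * Δ)
    have ht : 0 < t := by positivity
    refine ⟨Real.sqrt t, Real.sqrt_pos.2 ht, fun s hs hst => ?_⟩
    have hs2 : s ^ 2 ≤ t := by
      calc s ^ 2 ≤ (Real.sqrt t) ^ 2 := by gcongr
        _ = t := Real.sq_sqrt ht.le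
    set x := Q * s ^ 2 with hx
    have hx0 : 0 < x := by positivity
    set y := (Δ:ℝ) / 2 * x with hy
    have hy0 : 0 < y := by positivity
    have hy1 : y ≤ 1 / 3 := by
      calc y = Δ / 2 * Q * s ^ 2 := by rw [hy, hx]; ring
        _ ≤ Δ / 2 * Q * t := by gcongr
        _ = 1 / 3 := by simp only [t]; field_simp
    have h4 := Real.abs_exp_sub_one_sub_id_le (x := y) (by rw [abs_of_pos hy0]; linarith)
    have h5 := (abs_le.1 h4).2
    have h6 : Real.exp y ≤ g s := by
      have := h2 (by omega) s hs
      have e : ((Δ:ℝ) - 1) * Q * s ^ 2 = 2 * y - x := by rw [hy, hx]; ring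
      rw [e] at this
      have : x ≤ 2 / 3 * y := by rw [hy]; nlinarith
      nlinarith
    have h7 : y ≤ Real.log (g s) := by
      rw [Real.le_log_iff_exp_le (by have := Real.exp_pos y; linarith)]; exact h6
    have h8 : Real.log (1 + x) ≤ x := by
      have := Real.log_le_sub_one_of_pos (show 0 < 1 + x by linarith); linarith
    rw [one_div (Δ:ℝ), ← div_eq_inv_mul, le_div_iff₀ (by linarith)]
    calc 1 / 2 * Real.log (1 + x) * Δ ≤ 1 / 2 * x * Δ := by gcongr
      _ = y := by rw [hy]; ring
      _ ≤ _ := h7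
end aux



/-- Let q be a prime power and let C0 = RS(Δ0,k0) be a Reed–Solomon code over
F_q with weight enumerator g0(s).  Define
F1(δ) = h_q(δ) + δ·log_q(q−1) + 2·sup_{s>0}( δ·log_q(s) − (1/Δ0)·log_q(g0(s)) ).
Suppose δ1 ∈ (0,1) satisfies F1(δ1) = 0 and F1(δ) > 0 for all δ ∈ (0,δ1).  Then for every
ε ∈ (0,δ1), the fraction of quadruples (π1,c1,π2,c2) indexing the ensemble E1(Δ0,b)
(with n = bΔ0) whose code C(π1,c1,π2,c2) has minimum distance at least (δ1 − ε)·n tends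
to 1 as b → ∞. -/
theorem statement_9 (q Δ0 k0 : ℕ) (hq : IsPrimePow q)
    (F : Type) [Field F] [Fintype F] [DecidableEq F] (hF : Fintype.card F = q)
    (hk0 : 1 ≤ k0) (hk0' : k0 ≤ Δ0) (hΔ0q : Δ0 ≤ q)
    (α : Fin Δ0 → F) (hα : Function.Injective α)
    (C0 : Set (Fin Δ0 → F))
    (hC0 : C0 = {y | ∃ p : Polynomial F, p.degree < (k0 : ℕ) ∧ ∀ j, y j = p.eval (α j)})
    (g0 : ℝ → ℝ) (hg0 : ∀ s : ℝ, g0 s = ∑ᶠ y ∈ C0, s ^ hammingNorm y)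
    (F1 : ℝ → ℝ)
    (hF1 : ∀ δ : ℝ, F1 δ =
      (-δ * Real.logb q δ - (1 - δ) * Real.logb q (1 - δ)) + δ * Real.logb q ((q : ℝ) - 1)
        + 2 * sSup {x : ℝ | ∃ s : ℝ, 0 < s ∧
            x = δ * Real.logb q s - (1 / (Δ0 : ℝ)) * Real.logb q (g0 s)})
    (δ1 : ℝ) (hδ1 : 0 < δ1) (hδ1' : δ1 < 1)
    (hroot : F1 δ1 = 0) (hpos : ∀ δ : ℝ, 0 < δ → δ < δ1 → 0 < F1 δ)
    (ε : ℝ) (hε : 0 < ε) (hεδ : ε < δ1) :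
    Filter.Tendsto (fun b : ℕ =>
      (Nat.card {t : (Equiv.Perm (Fin b × Fin Δ0) × {c : Fin b × Fin Δ0 → F // ∀ j, c j ≠ 0}) ×
                     (Equiv.Perm (Fin b × Fin Δ0) × {c : Fin b × Fin Δ0 → F // ∀ j, c j ≠ 0}) //
          ∀ x : Fin b × Fin Δ0 → F,
            (∀ i : Fin b,
              (fun j => (t.1.2 : Fin b × Fin Δ0 → F) (i, j) * x (t.1.1 (i, j))) ∈ C0) →
            (∀ i : Fin b,
              (fun j => (t.2.2 : Fin b × Fin Δ0 → F) (i, j) * x (t.2.1 (i, j))) ∈ C0) →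
            x ≠ 0 → (δ1 - ε) * ((b * Δ0 : ℕ) : ℝ) ≤ (hammingNorm x : ℝ)} : ℝ)
        / (Nat.card
            ((Equiv.Perm (Fin b × Fin Δ0) × {c : Fin b × Fin Δ0 → F // ∀ j, c j ≠ 0}) ×
             (Equiv.Perm (Fin b × Fin Δ0) × {c : Fin b × Fin Δ0 → F // ∀ j, c j ≠ 0})) : ℝ))
      Filter.atTop (nhds 1) := by
  classical
  have hΔ : 0 < Δ0 := by omega
  have hΔr : (0:ℝ) < Δ0 := by exact_mod_cast hΔ
  have hq2 : 2 ≤ q := hq.two_le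
  have hqr : (2:ℝ) ≤ q := by exact_mod_cast hq2
  have hlq : 0 < Real.log q := Real.log_pos (by linarith)
  have hQ : (1:ℝ) ≤ (q:ℝ) - 1 := by linarith
  set C : Finset (Fin Δ0 → F) := Finset.univ.filter (fun y => y ∈ C0) with hCdef
  have hCm : ∀ y, y ∈ C ↔ y ∈ C0 := by intro y; simp [hCdef]
  have hC : ∀ y, y ∈ C ↔ ∃ p : Polynomial F, p.degree < (k0 : ℕ) ∧ ∀ j, y j = p.eval (α j) := by
    intro y; rw [hCm, hC0]; rfl
  have hg : ∀ s, g0 s = ∑ y ∈ C, s ^ hammingNorm y := by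
    intro s
    rw [hg0, ← finsum_mem_coe_finset]
    congr 1; ext y; simp only [Finset.mem_coe, hCm]
  have hgc : ∀ s, 0 < s → 1 + ((q:ℝ) - 1) * s ^ Δ0 ≤ g0 s := by
    intro s hs
    rw [hg, ← hF]; exact rs_const hk0 hΔ α C hC s hs
  have hgp : ∀ s, 0 < s → 0 < g0 s := by
    intro s hs
    have h := hgc s hs
    have : 0 ≤ ((q:ℝ) - 1) * s ^ Δ0 := by positivity
    linarith
  have hphi : ∀ δ, 0 < δ → δ < δ1 → ∃ s, 0 < s ∧ 0 < Phi Δ0 ((q:ℝ) - 1) g0 δ s := by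
    intro δ h1 h2
    by_contra hcon
    push Not at hcon
    have hp := hpos δ h1 h2
    rw [hF1] at hp
    have hsup : sSup {x : ℝ | ∃ s : ℝ, 0 < s ∧
            x = δ * Real.logb q s - (1 / (Δ0 : ℝ)) * Real.logb q (g0 s)} ≤
        -((Real.binEntropy δ + δ * Real.log ((q:ℝ) - 1)) / (2 * Real.log q)) := by
      apply csSup_le
      · exact ⟨_, 1, one_pos, rfl⟩
      · rintro x ⟨s, hs, rfl⟩
        have h := hcon s hs
        unfold Phi at h
        unfold Real.logb
        rw [← neg_div, le_div_iff₀ (by positivity)]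
        have e : (δ * (Real.log s / Real.log q) - 1 / (Δ0:ℝ) * (Real.log (g0 s) / Real.log q)) * (2 * Real.log q)
          = 2 * (δ * Real.log s - (1 / (Δ0:ℝ)) * Real.log (g0 s)) := by field_simp
        rw [e]; linarith
    have e2 : (-δ * Real.logb q δ - (1 - δ) * Real.logb q (1 - δ)) + δ * Real.logb q ((q : ℝ) - 1)
        = 2 * ((Real.binEntropy δ + δ * Real.log ((q:ℝ) - 1)) / (2 * Real.log q)) := by
      unfold Real.binEntropy Real.logb
      rw [Real.log_inv, Real.log_inv]; field_simp; ring
    rw [e2] at hp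
    linarith
  have hk2 : k0 + 2 ≤ Δ0 := by
    by_contra hcon
    obtain ⟨s0, hs0, hlow⟩ := aux_low Δ0 hΔ ((q:ℝ) - 1) hQ g0 hgc (by
      intro h2 s hs
      rw [hg, ← hF]; exact rs_star h2 (by omega) α hα C hC s hs)
    obtain ⟨δ, h1, h2, h3⟩ := aux_exclude Δ0 hΔ ((q:ℝ) - 1) hQ g0 (by
      intro s hs
      refine le_trans ?_ (hgc s hs)
      have : 0 < s ^ Δ0 := by positivity
      nlinarith) s0 hs0 hlow δ1 hδ1 hδ1'
    obtain ⟨s, hs, hp⟩ := hphi δ h1 h2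
    linarith [h3 s hs]
  have hT := aux_tendsto Δ0 hΔ ((q:ℝ) - 1) hQ g0
    (fun b w => ((Finset.univ.filter (fun x : Fin b × Fin Δ0 → F =>
      (∀ i, (fun j => x (i,j)) ∈ C0) ∧ hammingNorm x = w)).card : ℝ)) C.card
    (fun _ _ => Nat.cast_nonneg _) (Nat.cast_nonneg _) hgp
    (fun s hs hs1 => by rw [hg]; exact rs_upper hk2 α hα C hC s hs hs1)
    (fun b w s hs => by
      have := aux_gen (b := b) C s hs w
      simp only [hCm] at this
      rw [hg]; exact this)
    δ1 (δ1 - ε) hδ1' (by linarith) hphi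
  have hT1 := hT.const_sub 1
  rw [sub_zero] at hT1
  have hNpos : ∀ b : ℕ, (0:ℝ) < (Nat.card (MM (Fin b × Fin Δ0) F × MM (Fin b × Fin Δ0) F) : ℝ) := by
    intro b
    rw [Nat.card_eq_fintype_card]
    have : Nonempty (MM (Fin b × Fin Δ0) F) := ⟨(1, ⟨fun _ => 1, fun _ => one_ne_zero⟩)⟩
    exact_mod_cast Fintype.card_pos
  refine tendsto_of_tendsto_of_tendsto_of_le_of_le hT1 tendsto_const_nhds ?_ ?_
  · intro b
    have h := aux_first (F := F) (J := Fin b × Fin Δ0) (fun x => ∀ i, (fun j => x (i,j)) ∈ C0)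
      ((δ1 - ε) * ((b * Δ0 : ℕ) : ℝ))
    simp only [aux_sphere, Fintype.card_prod (Fin b) (Fin Δ0), Fintype.card_fin, hF] at h
    have hcast : ((q - 1 : ℕ) : ℝ) = (q:ℝ) - 1 := by rw [Nat.cast_sub (by omega)]; simp
    simp only [Nat.cast_mul (Nat.choose _ _), Nat.cast_pow, hcast] at h
    rw [← Nat.card_eq_fintype_card (α := MM (Fin b × Fin Δ0) F × MM (Fin b × Fin Δ0) F)] at h
    have hN := hNpos b
    show 1 - _ ≤ _
    rw [le_div_iff₀ hN, sub_mul, one_mul, sub_le_comm, mul_comm _ (Nat.card _ : ℝ)]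
    convert h <;> rfl
  · intro b
    show _ / _ ≤ (1:ℝ)
    apply div_le_one_of_le₀ _ (hNpos b).le
    exact_mod_cast Finite.card_subtype_le _
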